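/- arXiv:1308.6059 — 2 statements merged into one kernel-verified Lean document; each statement's English description precedes it below -/
import Mathlib

section
/- Let (Λ, S) be an artin local algebra with radical cubic zero (J³ = 0, where J is the Jacobson radical and S = Λ/J the simple module). If Λ is 1-Gorenstein, i.e., the G-dimension of S is at most 1 (there exists a short exact sequence 0 → K → G → S → 0 with G Gorenstein projective and K projective), then Λ is either 1-regular (the projective dimension of S is at most 1) or self-injective (Λ is injective as a left Λ-module). -/
universe u

/-! Basic notions from the representation theory of artin algebras.

An artin algebra is an algebra `Λ` over a commutative artinian ring `R` which is finitely
generated as an `R`-module.  All modules considered are (finitely generated) left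
`Λ`-modules. -/

/-- A (cochain) complex of projective `Λ`-modules which is totally acyclic: it is acyclic, and
applying `Hom_Λ(-, Q)` to it yields an acyclic complex for every projective `Λ`-module `Q`. -/
structure TotallyAcyclicComplex (Λ : Type u) [Ring Λ] where
  X : ℤ → Type u
  [acg : ∀ i, AddCommGroup (X i)]
  [mods : ∀ i, Module Λ (X i)]
  proj : ∀ i, Module.Projective Λ (X i)
  d : ∀ i, X i →ₗ[Λ] X (i + 1)
  dd : ∀ i, (d (i + 1)).comp (d i) = 0
  acyclic : ∀ i, LinearMap.range (d i) = LinearMap.ker (d (i + 1))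
  totally : ∀ (Q : Type u) [AddCommGroup Q] [Module Λ Q], Module.Projective Λ Q →
    ∀ (i : ℤ) (g : X (i + 1) →ₗ[Λ] Q), g.comp (d i) = 0 →
      ∃ h : X (i + 1 + 1) →ₗ[Λ] Q, h.comp (d (i + 1)) = g

attribute [instance] TotallyAcyclicComplex.acg TotallyAcyclicComplex.mods

/-- `M` is Gorenstein projective if it is isomorphic to the zeroth cocycle `Z⁰ = ker (d 0)` of a
totally acyclic complex of projective `Λ`-modules. -/
def IsGorensteinProjective (Λ : Type u) [Ring Λ] (M : Type u) [AddCommGroup M]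
    [Module Λ M] : Prop :=
  ∃ C : TotallyAcyclicComplex Λ, Nonempty (M ≃ₗ[Λ] LinearMap.ker (C.d 0))

/-- A submodule `N ≤ P` is superfluous if `K ⊔ N = ⊤` forces `K = ⊤`. -/
def IsSuperfluous {Λ : Type u} [Ring Λ] {P : Type u} [AddCommGroup P] [Module Λ P]
    (N : Submodule Λ P) : Prop :=
  ∀ K : Submodule Λ P, K ⊔ N = ⊤ → K = ⊤

/-- `p : P → M` is a projective cover: `P` is projective, `p` is surjective and `ker p` is
superfluous in `P`. -/
def IsProjectiveCover {Λ : Type u} [Ring Λ] {P M : Type u} [AddCommGroup P] [Module Λ P]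
    [AddCommGroup M] [Module Λ M] (p : P →ₗ[Λ] M) : Prop :=
  Module.Projective Λ P ∧ Function.Surjective p ∧ IsSuperfluous (LinearMap.ker p)

/-- An indecomposable module: nonzero, and admitting no nontrivial direct sum decomposition. -/
def IsIndecomposable (Λ : Type u) [Ring Λ] (M : Type u) [AddCommGroup M] [Module Λ M] : Prop :=
  Nontrivial M ∧ ∀ N N' : Submodule Λ M, IsCompl N N' → N = ⊥ ∨ N = ⊤

/-- A splittable monomorphism (section). -/
def IsSplitMono {Λ : Type u} [Ring Λ] {A B : Type u} [AddCommGroup A] [Module Λ A]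
    [AddCommGroup B] [Module Λ B] (f : A →ₗ[Λ] B) : Prop :=
  ∃ r : B →ₗ[Λ] A, r.comp f = LinearMap.id

/-- A splittable epimorphism (retraction). -/
def IsSplitEpi {Λ : Type u} [Ring Λ] {A B : Type u} [AddCommGroup A] [Module Λ A]
    [AddCommGroup B] [Module Λ B] (f : A →ₗ[Λ] B) : Prop :=
  ∃ s : B →ₗ[Λ] A, f.comp s = LinearMap.id

/-- An irreducible morphism in the category of finitely generated `Λ`-modules:
it is neither a splittable proper epimorphism nor a splittable proper monomorphism, and in any
factorization `f = h ∘ g` either `h` is a splittable epimorphism or `g` is a splittable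
monomorphism. -/
def IsIrreducibleHom (Λ : Type u) [Ring Λ] {B C : Type u} [AddCommGroup B] [Module Λ B]
    [AddCommGroup C] [Module Λ C] (f : B →ₗ[Λ] C) : Prop :=
  ¬ (IsSplitEpi f ∧ ¬ Function.Bijective f) ∧
  ¬ (IsSplitMono f ∧ ¬ Function.Bijective f) ∧
  ∀ (Z : Type u) [AddCommGroup Z] [Module Λ Z] [Module.Finite Λ Z]
    (g : B →ₗ[Λ] Z) (h : Z →ₗ[Λ] C), h.comp g = f → IsSplitEpi h ∨ IsSplitMono g

/-- A left almost split morphism in the category of finitely generated `Λ`-modules. -/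
def IsLeftAlmostSplit (Λ : Type u) [Ring Λ] {A B : Type u} [AddCommGroup A] [Module Λ A]
    [AddCommGroup B] [Module Λ B] (f : A →ₗ[Λ] B) : Prop :=
  ¬ IsSplitMono f ∧
  ∀ (X : Type u) [AddCommGroup X] [Module Λ X] [Module.Finite Λ X] (u : A →ₗ[Λ] X),
    ¬ IsSplitMono u → ∃ v : B →ₗ[Λ] X, v.comp f = u

/-- A right almost split morphism in the category of finitely generated `Λ`-modules. -/
def IsRightAlmostSplit (Λ : Type u) [Ring Λ] {B C : Type u} [AddCommGroup B] [Module Λ B]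
    [AddCommGroup C] [Module Λ C] (g : B →ₗ[Λ] C) : Prop :=
  ¬ IsSplitEpi g ∧
  ∀ (Y : Type u) [AddCommGroup Y] [Module Λ Y] [Module.Finite Λ Y] (u : Y →ₗ[Λ] C),
    ¬ IsSplitEpi u → ∃ v : Y →ₗ[Λ] B, g.comp v = u

/-- `0 → A →f B →g C → 0` is an almost split (Auslander–Reiten) sequence: it is a
short exact sequence, `f` is left almost split and `g` is right almost split. -/
def IsAlmostSplitSequence (Λ : Type u) [Ring Λ] {A B C : Type u} [AddCommGroup A] [Module Λ A]
    [AddCommGroup B] [Module Λ B] [AddCommGroup C] [Module Λ C]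
    (f : A →ₗ[Λ] B) (g : B →ₗ[Λ] C) : Prop :=
  Function.Injective f ∧ Function.Surjective g ∧ LinearMap.range f = LinearMap.ker g ∧
  IsLeftAlmostSplit Λ f ∧ IsRightAlmostSplit Λ g

/-- The product `I • N` of an ideal with a submodule: the span of products `a • m` with `a ∈ I`,
`m ∈ N`.  (Stated so as to make sense over a noncommutative ring.) -/
def idealSmul {Λ : Type u} [Ring Λ] (I : Ideal Λ) {M : Type u} [AddCommGroup M] [Module Λ M]
    (N : Submodule Λ M) : Submodule Λ M :=
  Submodule.span Λ {x | ∃ a ∈ I, ∃ m ∈ N, x = a • m}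

/-- `radPow Λ M k` is the submodule `Jᵏ M` of `M`, where `J` is the Jacobson radical of `Λ`.
In particular `radPow Λ Λ k` is the ideal `Jᵏ`. -/
def radPow (Λ : Type u) [Ring Λ] (M : Type u) [AddCommGroup M] [Module Λ M] :
    ℕ → Submodule Λ M
  | 0 => ⊤
  | k + 1 => idealSmul ((⊥ : Ideal Λ).jacobson) (radPow Λ M k)

theorem aux_gp_data {Λ : Type u} [Ring Λ] {G : Type u} [AddCommGroup G] [Module Λ G]
    (hG : IsGorensteinProjective Λ G) :
    ∃ (X F : Type u) (_ : AddCommGroup X) (_ : Module Λ X) (_ : AddCommGroup F) (_ : Module Λ F)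
      (_ : Module.Projective Λ X) (_ : Module.Projective Λ F) (q : X →ₗ[Λ] G) (i : G →ₗ[Λ] F),
      Function.Surjective q ∧ Function.Injective i ∧
      ∀ ψ : LinearMap.ker q →ₗ[Λ] Λ, ∃ h : X →ₗ[Λ] Λ, ∀ x : LinearMap.ker q, h x = ψ x := by
  obtain ⟨C, ⟨e0⟩⟩ := hG
  obtain ⟨i, hi⟩ : ∃ i : ℤ, i + 1 + 1 + 1 = 0 := ⟨-3, by norm_num⟩
  have key : ∀ k : ℤ, k = 0 → Nonempty (G ≃ₗ[Λ] LinearMap.ker (C.d k)) := by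
    rintro _ rfl
    exact ⟨e0⟩
  obtain ⟨e⟩ := key _ hi
  have hm : ∀ x, C.d (i + 1 + 1) x ∈ LinearMap.ker (C.d (i + 1 + 1 + 1)) := fun x => by
    rw [← C.acyclic]
    exact ⟨x, rfl⟩
  let q : C.X (i + 1 + 1) →ₗ[Λ] G :=
    e.symm.toLinearMap ∘ₗ (C.d (i + 1 + 1)).codRestrict _ hm
  have hq : ∀ x, q x = 0 ↔ C.d (i + 1 + 1) x = 0 := fun x => by
    simp [q, LinearMap.codRestrict, Subtype.ext_iff]
  have hkq : LinearMap.ker q = LinearMap.ker (C.d (i + 1 + 1)) := by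
    ext x
    simp [hq]
  refine ⟨C.X (i + 1 + 1), C.X (i + 1 + 1 + 1), inferInstance, inferInstance, inferInstance,
    inferInstance, C.proj _, C.proj _, q, Submodule.subtype _ ∘ₗ e.toLinearMap, ?_, ?_, ?_⟩
  · intro g
    obtain ⟨x, hx⟩ := (C.acyclic (i + 1 + 1)).ge (e g).2
    refine ⟨x, ?_⟩
    apply e.injective
    apply Subtype.ext
    simp [q, hx]
  · exact (Submodule.subtype_injective _).comp e.injective
  · intro ψ
    have hd : ∀ y, C.d (i + 1) y ∈ LinearMap.ker q := fun y => by
      rw [hkq, ← C.acyclic]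
      exact ⟨y, rfl⟩
    obtain ⟨h, hh⟩ := C.totally Λ inferInstance i (ψ ∘ₗ (C.d (i + 1)).codRestrict _ hd) (by
      ext y
      have h0 : (C.d (i + 1)).codRestrict _ hd (C.d i y) = 0 := by
        apply Subtype.ext
        simpa using LinearMap.congr_fun (C.dd i) y
      simp [h0])
    refine ⟨h, ?_⟩
    rintro ⟨x, hx⟩
    have hx' := hx
    rw [hkq, ← C.acyclic] at hx'
    obtain ⟨y, rfl⟩ := hx'
    exact LinearMap.congr_fun hh y

theorem aux_isUnit {Λ : Type u} [Ring Λ] [IsLocalRing Λ] {a : Λ}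
    (ha : a ∉ (⊥ : Ideal Λ).jacobson) : IsUnit a := by
  rw [Ideal.mem_jacobson_iff] at ha
  push Not at ha
  obtain ⟨y, hy⟩ := ha
  have h1 : ¬ IsUnit (y * a + 1) := by
    rintro ⟨v, hv⟩
    apply hy (v⁻¹ : Λˣ)
    have : ((v⁻¹ : Λˣ) : Λ) * (y * a + 1) = 1 := by rw [← hv]; simp
    rw [Ideal.mem_bot, mul_assoc]
    rw [mul_add, mul_one] at this
    rw [this, sub_self]
  have h2 : IsUnit (-(y * a)) :=
    (IsLocalRing.isUnit_or_isUnit_of_add_one (a := y * a + 1) (b := -(y * a))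
      (by abel)).resolve_left h1
  have h3 : IsUnit (y * a) := by simpa using h2.neg
  obtain ⟨v, hv⟩ := h3
  -- `c * a = 1`
  obtain ⟨c, hc⟩ : ∃ c, c * a = 1 :=
    ⟨(v⁻¹ : Λˣ) * y, by rw [mul_assoc, ← hv]; simp⟩
  have hidem : a * c * (a * c) = a * c := by
    rw [mul_assoc, ← mul_assoc c, hc, one_mul]
  rcases IsLocalRing.isUnit_or_isUnit_of_add_one (a := a * c) (b := 1 - a * c) (by abel) with h | h
  · have : a * c = 1 := h.mul_left_cancel (by rw [hidem, mul_one])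
    exact ⟨⟨a, c, this, hc⟩, rfl⟩
  · have h0 : (1 - a * c) * a = (1 - a * c) * 0 := by
      rw [sub_mul, mul_assoc, hc]; simp
    have : a = 0 := h.mul_left_cancel h0
    rw [this, mul_zero] at hc
    exact absurd hc zero_ne_one

theorem aux_coatom {Λ : Type u} [Ring Λ] [IsLocalRing Λ] :
    IsCoatom ((⊥ : Ideal Λ).jacobson) := by
  refine ⟨fun h => bot_ne_top (Ideal.jacobson_eq_top_iff.1 h), fun I hI => ?_⟩
  obtain ⟨x, hxI, hx⟩ := Set.exists_of_ssubset hI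
  exact Ideal.eq_top_of_isUnit_mem I hxI (aux_isUnit hx)

theorem aux_semisimple {Λ : Type u} [Ring Λ] [IsLocalRing Λ] (M : Type u) [AddCommGroup M]
    [Module Λ M] (hM : ∀ a ∈ (⊥ : Ideal Λ).jacobson, ∀ m : M, a • m = 0) :
    IsSemisimpleModule Λ M := by
  have hs : IsSimpleModule Λ (Λ ⧸ (⊥ : Ideal Λ).jacobson) :=
    isSimpleModule_iff_isCoatom.2 aux_coatom
  let f : M → (Λ ⧸ (⊥ : Ideal Λ).jacobson) →ₗ[Λ] M := fun m =>
    Submodule.liftQ _ (LinearMap.toSpanSingleton Λ M m) (fun a ha => by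
      simpa using hM a ha m)
  refine isSemisimpleModule_of_isSemisimpleModule_submodule'
    (p := fun m => LinearMap.range (f m)) (fun m => IsSemisimpleModule.range _) ?_
  rw [eq_top_iff]
  intro m _
  refine Submodule.mem_iSup_of_mem m ⟨Submodule.Quotient.mk 1, ?_⟩
  exact one_smul Λ m

/-- An injection between projectives splits. -/
theorem aux_split {Λ : Type u} [Ring Λ] [IsLocalRing Λ]
    (hJ : ∀ a ∈ (⊥ : Ideal Λ).jacobson, ∀ b ∈ (⊥ : Ideal Λ).jacobson,
      ∀ c ∈ (⊥ : Ideal Λ).jacobson, a * b * c = 0)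
    {K F : Type u} [AddCommGroup K] [Module Λ K] [AddCommGroup F] [Module Λ F]
    (hK : Module.Projective Λ K) (hF : Module.Projective Λ F)
    (i : K →ₗ[Λ] F) (hi : Function.Injective i) :
    ∃ r : F →ₗ[Λ] K, ∀ k, r (i k) = k := by
  obtain ⟨J, hJdef⟩ : ∃ J, J = (⊥ : Ideal Λ).jacobson := ⟨_, rfl⟩
  -- an element killed by `J` on the right
  obtain ⟨a, ha0, ha⟩ : ∃ a : Λ, a ≠ 0 ∧ ∀ j ∈ J, a * j = 0 := by
    rw [hJdef]
    by_cases h2 : ∃ b ∈ (⊥ : Ideal Λ).jacobson, ∃ c ∈ (⊥ : Ideal Λ).jacobson, b * c ≠ 0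
    · obtain ⟨b, hb, c, hc, hbc⟩ := h2
      exact ⟨b * c, hbc, fun j hj => hJ b hb c hc j hj⟩
    · push Not at h2
      by_cases h1 : ∃ b ∈ (⊥ : Ideal Λ).jacobson, b ≠ 0
      · obtain ⟨b, hb, hb0⟩ := h1
        exact ⟨b, hb0, fun j hj => h2 b hb j hj⟩
      · push Not at h1
        exact ⟨1, one_ne_zero, fun j hj => by simp [h1 j hj]⟩
  have hkill : ∀ x ∈ J • (⊤ : Submodule Λ F), a • x = 0 := by
    intro x hx
    refine Submodule.smul_induction_on (p := fun x => a • x = 0) hx ?_ ?_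
    · intro r hr n hn
      rw [← mul_smul, ha r hr, zero_smul]
    · intro x y hx hy
      rw [smul_add, hx, hy, add_zero]
  have hrev : ∀ x : K, i x ∈ J • (⊤ : Submodule Λ F) → x ∈ J • (⊤ : Submodule Λ K) := by
    intro x hx
    have hax : a • x = 0 := hi (by rw [map_smul, hkill _ hx, map_zero])
    obtain ⟨s, hs⟩ := hK.out
    have hc : ∀ k, s x k ∈ J := by
      intro k
      by_contra hk
      rw [hJdef] at hk
      have hu := aux_isUnit hk
      have : a * s x k = 0 := by
        have := congrArg (fun t => t k) (congrArg s hax)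
        simpa using this
      exact ha0 (hu.mul_right_cancel (by rw [this, zero_mul]))
    rw [← hs x, Finsupp.linearCombination_apply]
    exact Submodule.sum_mem _ fun k _ => Submodule.smul_mem_smul (hc k) trivial
  have hss : IsSemisimpleModule Λ (F ⧸ (J • (⊤ : Submodule Λ F))) := by
    apply aux_semisimple
    intro b hb m
    obtain ⟨m, rfl⟩ := Submodule.Quotient.mk_surjective _ m
    rw [← Submodule.Quotient.mk_smul, Submodule.Quotient.mk_eq_zero]
    exact Submodule.smul_mem_smul (hJdef ▸ hb) trivial
  have hle : J • (⊤ : Submodule Λ K) ≤ (J • (⊤ : Submodule Λ F)).comap i := by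
    rw [← Submodule.map_le_iff_le_comap, Submodule.map_smul'']
    exact Submodule.smul_mono le_rfl le_top
  let ibar : (K ⧸ (J • (⊤ : Submodule Λ K))) →ₗ[Λ] (F ⧸ (J • (⊤ : Submodule Λ F))) :=
    Submodule.mapQ _ _ i hle
  have hibar : Function.Injective ibar := by
    rw [injective_iff_map_eq_zero]
    intro k hk
    obtain ⟨k, rfl⟩ := Submodule.Quotient.mk_surjective _ k
    rw [Submodule.Quotient.mk_eq_zero]
    apply hrev
    rw [← Submodule.Quotient.mk_eq_zero]
    exact hk
  obtain ⟨ρ, hρ⟩ := IsSemisimpleModule.extension_property ibar hibar LinearMap.id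
  obtain ⟨r, hr⟩ := Module.projective_lifting_property (Submodule.mkQ (J • (⊤ : Submodule Λ K)))
    (ρ ∘ₗ Submodule.mkQ (J • (⊤ : Submodule Λ F))) (Submodule.mkQ_surjective _)
  let f : Module.End Λ K := 1 - r ∘ₗ i
  have hf1 : ∀ k, f k ∈ J • (⊤ : Submodule Λ K) := by
    intro k
    rw [← Submodule.Quotient.mk_eq_zero]
    have h1 := LinearMap.congr_fun hr (i k)
    have h2 := LinearMap.congr_fun hρ (Submodule.Quotient.mk k)
    simp only [LinearMap.comp_apply, Submodule.mkQ_apply, LinearMap.id_apply] at h1 h2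
    have h3 : ibar (Submodule.Quotient.mk k) = Submodule.Quotient.mk (i k) := rfl
    rw [h3] at h2
    simp only [f, LinearMap.sub_apply, Submodule.Quotient.mk_sub, LinearMap.comp_apply, h1, h2]
    simp
  have hmap : ∀ N : Submodule Λ K, ∀ x ∈ J • N, f x ∈ J • N.map f := fun N x hx => by
    rw [← Submodule.map_smul'']
    exact ⟨x, hx, rfl⟩
  have hr1 : (⊤ : Submodule Λ K).map f ≤ J • ⊤ := by
    rintro _ ⟨x, -, rfl⟩
    exact hf1 x
  have hr2 : (J • (⊤ : Submodule Λ K)).map f ≤ J • (J • ⊤) := by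
    rw [Submodule.map_smul'']
    exact Submodule.smul_mono le_rfl hr1
  have hzero : J • (J • (J • (⊤ : Submodule Λ K))) ≤ ⊥ := by
    rw [Submodule.smul_le]
    intro b hb n hn
    rw [Submodule.mem_bot]
    refine Submodule.smul_induction_on (p := fun x => b • x = 0) hn ?_ ?_
    · intro c hc n hn
      refine Submodule.smul_induction_on (p := fun x => b • c • x = 0) hn ?_ ?_
      · intro d hd n hn
        subst hJdef
        rw [← mul_smul, ← mul_smul, hJ b hb c hc d hd, zero_smul]
      · intro x y hx hy
        rw [smul_add, smul_add, hx, hy, add_zero]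
    · intro x y hx hy
      rw [smul_add, hx, hy, add_zero]
  have hf3 : f ^ 3 = 0 := by
    ext k
    have h2 : f (f k) ∈ J • (J • (⊤ : Submodule Λ K)) := hr2 ⟨f k, hf1 k, rfl⟩
    have h3 := Submodule.smul_mono (le_refl J) hr2 (hmap _ _ h2)
    have := hzero h3
    rw [Submodule.mem_bot] at this
    simpa [pow_succ] using this
  have hu : IsUnit (r ∘ₗ i : Module.End Λ K) := by
    have := IsNilpotent.isUnit_one_sub (r := f) ⟨3, hf3⟩
    simpa [f] using this
  obtain ⟨v, hv⟩ := hu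
  refine ⟨((v⁻¹ : (Module.End Λ K)ˣ) : Module.End Λ K) ∘ₗ r, fun k => ?_⟩
  have h1 : ((v⁻¹ : (Module.End Λ K)ˣ) : Module.End Λ K) * (v : Module.End Λ K) = 1 := by simp
  rw [hv] at h1
  exact LinearMap.congr_fun h1 k

theorem aux_baer {Λ : Type u} [Ring Λ] [IsLocalRing Λ] [IsNoetherian Λ Λ]
    (hJ : ∀ a ∈ (⊥ : Ideal Λ).jacobson, ∀ b ∈ (⊥ : Ideal Λ).jacobson,
      ∀ c ∈ (⊥ : Ideal Λ).jacobson, a * b * c = 0)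
    (hext : ∀ φ : (⊥ : Ideal Λ).jacobson →ₗ[Λ] Λ, ∃ c : Λ, ∀ j, φ j = (j : Λ) * c) :
    Module.Baer Λ Λ := by
  intro I
  induction I using WellFoundedGT.induction with
  | ind I ih =>
  intro g
  by_cases hI : I = ⊤
  · subst hI
    exact ⟨g ∘ₗ Submodule.topEquiv.symm.toLinearMap, fun x hx => rfl⟩
  have h1I : (1 : Λ) ∉ I := fun h => hI ((Ideal.eq_top_iff_one I).2 h)
  obtain ⟨x, hxI, hx⟩ : ∃ x ∉ I, ∀ j ∈ (⊥ : Ideal Λ).jacobson, j * x ∈ I := by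
    by_cases h1 : ∃ b ∈ (⊥ : Ideal Λ).jacobson, b ∉ I
    · by_cases h2 : ∃ b ∈ (⊥ : Ideal Λ).jacobson, ∃ c ∈ (⊥ : Ideal Λ).jacobson, b * c ∉ I
      · obtain ⟨b, hb, c, hc, hbc⟩ := h2
        refine ⟨b * c, hbc, fun j hj => ?_⟩
        rw [← mul_assoc, hJ j hj b hb c hc]
        exact I.zero_mem
      · push Not at h2
        obtain ⟨b, hb, hbI⟩ := h1
        exact ⟨b, hbI, fun j hj => h2 j hj b hb⟩
    · push Not at h1
      exact ⟨1, h1I, fun j hj => by simpa using h1 j hj⟩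
  let φ : (⊥ : Ideal Λ).jacobson →ₗ[Λ] Λ :=
    g ∘ₗ ((LinearMap.toSpanSingleton Λ Λ x).domRestrict _).codRestrict I
      (fun j => by simpa using hx j j.2)
  obtain ⟨c, hc⟩ := hext φ
  have hmem : ∀ l : Λ, l * x ∈ I → l ∈ (⊥ : Ideal Λ).jacobson := by
    intro l hl
    by_contra hlJ
    obtain ⟨v, rfl⟩ := aux_isUnit hlJ
    exact hxI (by simpa [← mul_assoc] using I.mul_mem_left ((v⁻¹ : Λˣ) : Λ) hl)
  have hgc : ∀ (l : Λ) (hl : l * x ∈ I), g ⟨l * x, hl⟩ = l * c := fun l hl =>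
    hc ⟨l, hmem l hl⟩
  let P : Λ →ₗ.[Λ] Λ := ⟨I, g⟩
  have hH : ∀ l : Λ, l • x = 0 → (RingHom.id Λ) l • c = 0 := fun l hl => by
    have hl' : l * x = 0 := hl
    have h0 : l * x ∈ I := by rw [hl']; exact I.zero_mem
    have h1 := hgc l h0
    have h2 : (⟨l * x, h0⟩ : I) = 0 := Subtype.ext hl'
    rw [h2, map_zero] at h1
    exact h1.symm
  let Q : Λ →ₗ.[Λ] Λ := LinearPMap.mkSpanSingleton' x c hH
  have hPQ : ∀ (y : P.domain) (z : Q.domain), (y : Λ) = z → P y = Q z := by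
    rintro ⟨y, hy⟩ ⟨z, hz⟩ (rfl : y = z)
    obtain ⟨l, rfl⟩ := Submodule.mem_span_singleton.1 hz
    have h1 := LinearPMap.mkSpanSingleton'_apply x c hH l hz
    exact (hgc l hy).trans h1.symm
  have hlt : I < I ⊔ Submodule.span Λ {x} := by
    refine lt_of_le_of_ne le_sup_left fun h => hxI ?_
    rw [h]
    exact Submodule.mem_sup_right (Submodule.mem_span_singleton_self x)
  obtain ⟨g', hg'⟩ := ih _ hlt (P.sup Q hPQ).toFun
  refine ⟨g', fun y hy => ?_⟩
  rw [hg' y (Submodule.mem_sup_left hy)]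
  exact ((LinearPMap.left_le_sup P Q hPQ).2 (x := ⟨y, hy⟩)
    (y := ⟨y, Submodule.mem_sup_left hy⟩) rfl).symm

/-- Let `(Λ, S)` be an artin local algebra with radical cubic zero
(`J³ = 0`, `S = Λ/J`).  If `Λ` is 1-Gorenstein, i.e. there is a short exact sequence
`0 → K → G → S → 0` with `G` Gorenstein projective and `K` projective, then `Λ` is either
1-regular (the projective dimension of `S` is at most 1, i.e. `S` has a projective resolution
of length 1) or self-injective (`Λ` is injective as a left `Λ`-module). -/
theorem artin_local_radical_cube_zero_one_Gorenstein
    (R : Type u) [CommRing R] [IsArtinianRing R]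
    (Λ : Type u) [Ring Λ] [Algebra R Λ] [Module.Finite R Λ] [IsLocalRing Λ]
    (hJ3 : radPow Λ Λ 3 = ⊥)
    (K G : Type u) [AddCommGroup K] [Module Λ K] [AddCommGroup G] [Module Λ G]
    [Module.Finite Λ K] [Module.Finite Λ G]
    (hK : Module.Projective Λ K) (hG : IsGorensteinProjective Λ G)
    (ι : K →ₗ[Λ] G) (π : G →ₗ[Λ] (Λ ⧸ (⊥ : Ideal Λ).jacobson))
    (hι : Function.Injective ι) (hπ : Function.Surjective π)
    (hexact : LinearMap.range ι = LinearMap.ker π) :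
    (∃ (n : ℕ) (f : (Fin n → Λ) →ₗ[Λ] (Λ ⧸ (⊥ : Ideal Λ).jacobson)),
        Function.Surjective f ∧ Module.Projective Λ ↥(LinearMap.ker f)) ∨
      Module.Injective Λ Λ := by
  right
  have hJ : ∀ a ∈ (⊥ : Ideal Λ).jacobson, ∀ b ∈ (⊥ : Ideal Λ).jacobson,
      ∀ c ∈ (⊥ : Ideal Λ).jacobson, a * b * c = 0 := by
    intro a ha b hb c hc
    have h1 : c ∈ radPow Λ Λ 1 :=
      Submodule.subset_span ⟨c, hc, 1, trivial, by simp⟩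
    have h2 : b * c ∈ radPow Λ Λ 2 := Submodule.subset_span ⟨b, hb, c, h1, rfl⟩
    have h3 : a * (b * c) ∈ radPow Λ Λ 3 := Submodule.subset_span ⟨a, ha, _, h2, rfl⟩
    rw [hJ3, Submodule.mem_bot] at h3
    rw [mul_assoc, h3]
  have hNR : IsNoetherian R Λ := isNoetherian_of_isNoetherianRing_of_finite R Λ
  have hN : IsNoetherian Λ Λ := isNoetherian_of_tower R hNR
  apply Module.Baer.injective
  refine aux_baer hJ fun φ => ?_
  obtain ⟨X, F, _, _, _, _, hX, hF, q, i, hq, hi, hψ⟩ := aux_gp_data hG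
  obtain ⟨r, hr⟩ := aux_split hJ hK hF (i ∘ₗ ι) (hi.comp hι)
  obtain ⟨g1, hg1⟩ := hπ (Submodule.Quotient.mk 1)
  -- a socle element of `G` mapping to `1`
  let g0 : G := g1 - ι (r (i g1))
  have hπι : ∀ k, π (ι k) = 0 := fun k => by
    have : ι k ∈ LinearMap.ker π := hexact ▸ ⟨k, rfl⟩
    exact this
  have hg0 : π g0 = Submodule.Quotient.mk 1 := by simp [g0, hπι, hg1]
  have hg0J : ∀ j ∈ (⊥ : Ideal Λ).jacobson, j • g0 = 0 := by
    intro j hj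
    have h1 : j • g1 ∈ LinearMap.ker π := by
      rw [LinearMap.mem_ker, map_smul, hg1, ← Submodule.Quotient.mk_smul,
        Submodule.Quotient.mk_eq_zero]
      simpa using hj
    rw [← hexact] at h1
    obtain ⟨k, hk⟩ := h1
    have h2 : r (i (ι k)) = k := hr k
    simp only [g0, smul_sub, ← map_smul]
    rw [← hk, h2, sub_self]
  obtain ⟨x0, hx0⟩ := hq g0
  obtain ⟨θ, hθ⟩ := Module.projective_lifting_property
    (Submodule.mkQ ((⊥ : Ideal Λ).jacobson)) (π ∘ₗ q) (Submodule.mkQ_surjective _)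
  have hθ' : ∀ x, (Submodule.Quotient.mk (θ x) : Λ ⧸ (⊥ : Ideal Λ).jacobson) = π (q x) :=
    fun x => LinearMap.congr_fun hθ x
  have hθJ : ∀ x : LinearMap.ker q, θ x ∈ (⊥ : Ideal Λ).jacobson := by
    rintro ⟨x, hx⟩
    rw [← Submodule.Quotient.mk_eq_zero, hθ', LinearMap.mem_ker.1 hx, map_zero]
  obtain ⟨h, hh⟩ := hψ (φ ∘ₗ (θ.domRestrict _).codRestrict _ hθJ)
  have hu : IsUnit (θ x0) := by
    apply aux_isUnit
    rw [← Submodule.Quotient.mk_eq_zero, hθ', hx0, hg0, Submodule.Quotient.mk_eq_zero,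
      ← Ideal.eq_top_iff_one]
    exact aux_coatom.1
  obtain ⟨v, hv⟩ := hu
  refine ⟨h (((v⁻¹ : Λˣ) : Λ) • x0), fun j => ?_⟩
  have hk : (j : Λ) • ((v⁻¹ : Λˣ) : Λ) • x0 ∈ LinearMap.ker q := by
    rw [LinearMap.mem_ker, map_smul, map_smul, hx0, ← mul_smul]
    exact hg0J _ (Ideal.mul_mem_right _ _ j.2)
  have h1 := hh ⟨_, hk⟩
  have h2 : (θ.domRestrict _).codRestrict _ hθJ ⟨_, hk⟩ = j := by
    apply Subtype.ext
    change θ ((j : Λ) • ((v⁻¹ : Λˣ) : Λ) • x0) = j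
    rw [map_smul, map_smul, ← hv]
    simp
  rw [LinearMap.comp_apply, h2] at h1
  rw [← h1, map_smul, smul_eq_mul]
end

section
/- Let Λ be an artin algebra and M a finitely generated Gorenstein projective Λ-module which is indecomposable and non-projective. Then its syzygy Ω(M), the kernel of a projective cover P → M, is also an indecomposable non-projective Gorenstein projective Λ-module. -/
universe u

/-- The objects of the modified complex. -/
def newX {Λ : Type u} [Ring Λ] (C : TotallyAcyclicComplex Λ) (P X' : Type u) : ℤ → Type u
  | .ofNat 0 => P
  | .ofNat (n+1) => C.X (Int.ofNat n)
  | .negSucc 0 => X'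
  | .negSucc (n+1) => C.X (Int.negSucc (n+2))

@[reducible] def newAcg {Λ : Type u} [Ring Λ] (C : TotallyAcyclicComplex Λ) (P X' : Type u)
    [AddCommGroup P] [AddCommGroup X'] : ∀ i, AddCommGroup (newX C P X' i)
  | .ofNat 0 => inferInstanceAs (AddCommGroup P)
  | .ofNat (n+1) => inferInstanceAs (AddCommGroup (C.X (Int.ofNat n)))
  | .negSucc 0 => inferInstanceAs (AddCommGroup X')
  | .negSucc (n+1) => inferInstanceAs (AddCommGroup (C.X (Int.negSucc (n+2))))

attribute [local instance] newAcg

@[reducible] def newMod {Λ : Type u} [Ring Λ] (C : TotallyAcyclicComplex Λ) (P X' : Type u)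
    [AddCommGroup P] [AddCommGroup X'] [Module Λ P] [Module Λ X'] :
    ∀ i, Module Λ (newX C P X' i)
  | .ofNat 0 => inferInstanceAs (Module Λ P)
  | .ofNat (n+1) => inferInstanceAs (Module Λ (C.X (Int.ofNat n)))
  | .negSucc 0 => inferInstanceAs (Module Λ X')
  | .negSucc (n+1) => inferInstanceAs (Module Λ (C.X (Int.negSucc (n+2))))

attribute [local instance] newMod

def newD {Λ : Type u} [Ring Λ] (C : TotallyAcyclicComplex Λ) (P X' : Type u)
    [AddCommGroup P] [AddCommGroup X'] [Module Λ P] [Module Λ X']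
    (f3 : C.X (Int.negSucc 2) →ₗ[Λ] X') (f2 : X' →ₗ[Λ] P) (f1 : P →ₗ[Λ] C.X (Int.ofNat 0)) :
    ∀ i, newX C P X' i →ₗ[Λ] newX C P X' (i+1)
  | .ofNat 0 => f1
  | .ofNat (n+1) => C.d (Int.ofNat n)
  | .negSucc 0 => f2
  | .negSucc 1 => f3
  | .negSucc (n+2) => C.d (Int.negSucc (n+3))

theorem ker_GP_aux {Λ : Type u} [Ring Λ] (C : TotallyAcyclicComplex Λ) (P X' : Type u)
    [AddCommGroup P] [AddCommGroup X'] [Module Λ P] [Module Λ X']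
    (hP : Module.Projective Λ P) (hX' : Module.Projective Λ X')
    (f3 : C.X (Int.negSucc 2) →ₗ[Λ] X') (f2 : X' →ₗ[Λ] P) (f1 : P →ₗ[Λ] C.X (Int.ofNat 0))
    (e4 : LinearMap.range (C.d (Int.negSucc 3)) = LinearMap.ker f3)
    (e3 : LinearMap.range f3 = LinearMap.ker f2)
    (e2 : LinearMap.range f2 = LinearMap.ker f1)
    (e1 : LinearMap.range f1 = LinearMap.ker (C.d (Int.ofNat 0)))
    (t4 : ∀ (Q : Type u) [AddCommGroup Q] [Module Λ Q], Module.Projective Λ Q →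
      ∀ g : C.X (Int.negSucc 2) →ₗ[Λ] Q,
        (∀ x : C.X (Int.negSucc 3), g (C.d (Int.negSucc 3) x) = 0) →
        ∃ h : X' →ₗ[Λ] Q, h.comp f3 = g)
    (t3 : ∀ (Q : Type u) [AddCommGroup Q] [Module Λ Q], Module.Projective Λ Q →
      ∀ g : X' →ₗ[Λ] Q, g.comp f3 = 0 → ∃ h : P →ₗ[Λ] Q, h.comp f2 = g)
    (t2 : ∀ (Q : Type u) [AddCommGroup Q] [Module Λ Q], Module.Projective Λ Q →
      ∀ g : P →ₗ[Λ] Q, g.comp f2 = 0 → ∃ h : C.X (Int.ofNat 0) →ₗ[Λ] Q, h.comp f1 = g)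
    (t1 : ∀ (Q : Type u) [AddCommGroup Q] [Module Λ Q], Module.Projective Λ Q →
      ∀ g : C.X (Int.ofNat 0) →ₗ[Λ] Q, g.comp f1 = 0 →
        ∃ h : C.X (Int.ofNat 0 + 1) →ₗ[Λ] Q, h.comp (C.d (Int.ofNat 0)) = g) :
    IsGorensteinProjective Λ (LinearMap.ker f1) := by
  have hac : ∀ i, LinearMap.range (newD C P X' f3 f2 f1 i)
      = LinearMap.ker (newD C P X' f3 f2 f1 (i+1)) := fun i =>
    match i with
    | .ofNat 0 => e1
    | .ofNat (n+1) => C.acyclic (Int.ofNat n)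
    | .negSucc 0 => e2
    | .negSucc 1 => e3
    | .negSucc 2 => e4
    | .negSucc (n+3) => C.acyclic (Int.negSucc (n+4))
  refine ⟨{ X := newX C P X', d := newD C P X' f3 f2 f1, proj := ?_, dd := ?_, acyclic := hac, totally := ?_ }, ⟨LinearEquiv.refl Λ (LinearMap.ker f1)⟩⟩
  · exact fun i => match i with
      | .ofNat 0 => hP
      | .ofNat (n+1) => C.proj (Int.ofNat n)
      | .negSucc 0 => hX'
      | .negSucc (n+1) => C.proj (Int.negSucc (n+2))
  · intro i
    exact LinearMap.range_le_ker_iff.mp (hac i).le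
  · intro Q _ _ hQ i
    exact match i with
      | .ofNat 0 => t1 Q hQ
      | .ofNat (n+1) => C.totally Q hQ (Int.ofNat n)
      | .negSucc 0 => t2 Q hQ
      | .negSucc 1 => t3 Q hQ
      | .negSucc 2 => fun g hg => t4 Q hQ g (fun x => LinearMap.congr_fun hg x)
      | .negSucc (n+3) => C.totally Q hQ (Int.negSucc (n+4))

/-- Every map from the kernel of a projective cover of a Gorenstein projective to a projective
extends, and the kernel is Gorenstein projective. -/
theorem ker_GP_main {Λ : Type u} [Ring Λ] (M : Type u) [AddCommGroup M] [Module Λ M]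
    (hM : IsGorensteinProjective Λ M) (P : Type u) [AddCommGroup P] [Module Λ P]
    (p : P →ₗ[Λ] M) (hp : IsProjectiveCover p) :
    IsGorensteinProjective Λ (LinearMap.ker p) ∧
    ∀ (Q : Type u) [AddCommGroup Q] [Module Λ Q], Module.Projective Λ Q →
      ∀ f : LinearMap.ker p →ₗ[Λ] Q, ∃ h : P →ₗ[Λ] Q, ∀ x : LinearMap.ker p, h x = f x := by
  obtain ⟨C, ⟨eM⟩⟩ := hM
  obtain ⟨hP, hps, hpk⟩ := hp
  let X0 := C.X (Int.ofNat 0)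
  let X1 := C.X (Int.negSucc 0)
  let X2 := C.X (Int.negSucc 1)
  let X3 := C.X (Int.negSucc 2)
  let d1 : X1 →ₗ[Λ] X0 := C.d (Int.negSucc 0)
  let d2 : X2 →ₗ[Λ] X1 := C.d (Int.negSucc 1)
  let d3 : X3 →ₗ[Λ] X2 := C.d (Int.negSucc 2)
  have a1 : LinearMap.range d1 = LinearMap.ker (C.d (Int.ofNat 0)) := C.acyclic (Int.negSucc 0)
  have a2 : LinearMap.range d2 = LinearMap.ker d1 := C.acyclic (Int.negSucc 1)
  have a3 : LinearMap.range d3 = LinearMap.ker d2 := C.acyclic (Int.negSucc 2)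
  have a4 : LinearMap.range (C.d (Int.negSucc 3)) = LinearMap.ker d3 := C.acyclic (Int.negSucc 3)
  have hX1 : Module.Projective Λ X1 := C.proj _
  have hX2 : Module.Projective Λ X2 := C.proj _
  -- the map `M → X0`
  let j : M →ₗ[Λ] X0 := (LinearMap.ker (C.d (Int.ofNat 0))).subtype ∘ₗ eM.toLinearMap
  have hj : Function.Injective j := Subtype.val_injective.comp eM.injective
  have hjr : LinearMap.range j = LinearMap.ker (C.d (Int.ofNat 0)) := by
    rw [LinearMap.range_comp, LinearEquiv.range, Submodule.map_top, Submodule.range_subtype]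
  have hd1mem : ∀ x, d1 x ∈ LinearMap.ker (C.d (Int.ofNat 0)) := fun x => a1 ▸ ⟨x, rfl⟩
  let π : X1 →ₗ[Λ] M := eM.symm.toLinearMap ∘ₗ LinearMap.codRestrict _ d1 hd1mem
  have hjπ : ∀ x, j (π x) = d1 x := by
    intro x
    change ((eM (eM.symm (LinearMap.codRestrict _ d1 hd1mem x)) : LinearMap.ker (C.d (Int.ofNat 0))) : X0) = d1 x
    rw [LinearEquiv.apply_symm_apply]; rfl
  have hπs : Function.Surjective π := by
    intro m
    have : j m ∈ LinearMap.range d1 := by rw [a1, ← hjr]; exact ⟨m, rfl⟩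
    obtain ⟨x, hx⟩ := this
    exact ⟨x, hj (by rw [hjπ, hx])⟩
  obtain ⟨a, ha⟩ := Module.projective_lifting_property p π hps
  have ha' : ∀ x, p (a x) = π x := fun x => LinearMap.congr_fun ha x
  have has : Function.Surjective a := by
    rw [← LinearMap.range_eq_top]
    apply hpk
    rw [eq_top_iff]
    intro y _
    obtain ⟨x, hx⟩ := hπs (p y)
    rw [Submodule.mem_sup]
    refine ⟨a x, ⟨x, rfl⟩, y - a x, ?_, by abel⟩
    rw [LinearMap.mem_ker, map_sub, ha', hx, sub_self]
  obtain ⟨b, hb⟩ := Module.projective_lifting_property a LinearMap.id has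
  have hb' : ∀ y, a (b y) = y := fun y => LinearMap.congr_fun hb y
  have hπb : ∀ y, π (b y) = p y := fun y => by rw [← ha', hb']
  let f1 : P →ₗ[Λ] X0 := j ∘ₗ p
  have hf1a : ∀ x, f1 (a x) = d1 x := fun x => by
    change j (p (a x)) = _
    rw [ha', hjπ]
  have hd1b : ∀ y, d1 (b y) = f1 y := fun y => by rw [← hf1a, hb']
  have hkf1 : LinearMap.ker f1 = LinearMap.ker p :=
    LinearMap.ker_comp_of_ker_eq_bot _ (LinearMap.ker_eq_bot.mpr hj)
  let e : X1 →ₗ[Λ] X1 := LinearMap.id - b ∘ₗ a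
  have he : ∀ x, e x = x - b (a x) := fun x => rfl
  have hae : ∀ x, a (e x) = 0 := fun x => by rw [he, map_sub, hb', sub_self]
  have hee : ∀ x, e (e x) = e x := fun x => by rw [he (e x), hae, map_zero, sub_zero]
  have hde : ∀ x, e x ∈ LinearMap.range d2 := fun x => by
    rw [a2, LinearMap.mem_ker, ← hf1a, hae, map_zero]
  obtain ⟨c, hc⟩ := Module.projective_lifting_property d2.rangeRestrict
    (LinearMap.codRestrict _ e hde) d2.surjective_rangeRestrict
  have hc' : ∀ x, d2 (c x) = e x := fun x =>
    congrArg Subtype.val (LinearMap.congr_fun hc x)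
  let X' : Submodule Λ X2 := LinearMap.ker (e ∘ₗ d2)
  have hX'mem : ∀ x, x ∈ X' ↔ e (d2 x) = 0 := fun x => Iff.rfl
  have hrmem : ∀ x, (LinearMap.id - c ∘ₗ e ∘ₗ d2 : X2 →ₗ[Λ] X2) x ∈ X' := fun x => by
    rw [hX'mem]
    change e (d2 (x - c (e (d2 x)))) = 0
    rw [map_sub, hc', map_sub, hee, hee, sub_self]
  let r : X2 →ₗ[Λ] X' := LinearMap.codRestrict _ _ hrmem
  have hr : ∀ x, (r x : X2) = x - c (e (d2 x)) := fun x => rfl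
  have hr' : ∀ x : X', r x = x := fun x => Subtype.ext (by
    rw [hr, (hX'mem _).1 x.2, map_zero, sub_zero])
  have hX'p : Module.Projective Λ X' :=
    Module.Projective.of_split X'.subtype r (LinearMap.ext hr')
  have hd23 : ∀ x, d2 (d3 x) = 0 := fun x => by
    have : d3 x ∈ LinearMap.range d3 := ⟨x, rfl⟩
    rwa [a3] at this
  have hd12 : ∀ x, d1 (d2 x) = 0 := fun x => by
    have : d2 x ∈ LinearMap.range d2 := ⟨x, rfl⟩
    rwa [a2] at this
  have hf3mem : ∀ x, d3 x ∈ X' := fun x => by rw [hX'mem, hd23, map_zero]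
  let f3 : X3 →ₗ[Λ] X' := LinearMap.codRestrict _ d3 hf3mem
  have hf3 : ∀ x, (f3 x : X2) = d3 x := fun x => rfl
  let f2 : X' →ₗ[Λ] P := a ∘ₗ d2 ∘ₗ X'.subtype
  have hf2 : ∀ x : X', f2 x = a (d2 x) := fun x => rfl
  have hbf2 : ∀ x : X', b (f2 x) = d2 x := fun x => by
    have := (hX'mem _).1 x.2
    rw [he, sub_eq_zero] at this
    exact this.symm
  have e3 : LinearMap.range f3 = LinearMap.ker f2 := by
    ext x
    rw [LinearMap.mem_ker]
    constructor
    · rintro ⟨y, rfl⟩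
      rw [hf2, hf3, hd23, map_zero]
    · intro hx
      have h1 : (x : X2) ∈ LinearMap.ker d2 := by
        rw [LinearMap.mem_ker, ← hbf2, hx, map_zero]
      rw [← a3] at h1
      obtain ⟨y, hy⟩ := h1
      exact ⟨y, Subtype.ext hy⟩
  have e2 : LinearMap.range f2 = LinearMap.ker f1 := by
    ext y
    rw [LinearMap.mem_ker]
    constructor
    · rintro ⟨x, rfl⟩
      rw [← hd1b, hbf2, hd12]
    · intro hy
      have h1 : b y ∈ LinearMap.range d2 := by
        rw [a2, LinearMap.mem_ker, hd1b, hy]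
      obtain ⟨x, hx⟩ := h1
      refine ⟨⟨x, ?_⟩, ?_⟩
      · rw [hX'mem, hx, he, hb', sub_self]
      · rw [hf2, hx, hb']
  have t3 : ∀ (Q : Type u) [AddCommGroup Q] [Module Λ Q], Module.Projective Λ Q →
      ∀ g : X' →ₗ[Λ] Q, g.comp f3 = 0 → ∃ h : P →ₗ[Λ] Q, h.comp f2 = g := by
    intro Q _ _ hQ g hg
    have h0 : (g ∘ₗ r).comp d3 = 0 := by
      ext x
      have : r (d3 x) = f3 x := hr' (f3 x)
      change g (r (d3 x)) = 0
      rw [this]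
      exact LinearMap.congr_fun hg x
    obtain ⟨h, hh⟩ := C.totally Q hQ (Int.negSucc 2) (g ∘ₗ r) h0
    have hh' : ∀ x : X2, (h : X1 →ₗ[Λ] Q) (d2 x) = g (r x) := fun x => LinearMap.congr_fun hh x
    refine ⟨(h : X1 →ₗ[Λ] Q) ∘ₗ b, ?_⟩
    ext x
    change (h : X1 →ₗ[Λ] Q) (b (f2 x)) = g x
    rw [hbf2, hh', hr']
  constructor
  · rw [← hkf1]
    refine ker_GP_aux C P X' hP hX'p f3 f2 f1 ?_ e3 e2 ?_ ?_ t3 ?_ ?_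
    · rw [a4]; exact (LinearMap.ker_codRestrict _ _ _).symm
    · rw [← hjr]; exact LinearMap.range_comp_of_range_eq_top _ (LinearMap.range_eq_top.mpr hps)
    · intro Q _ _ hQ g hg
      obtain ⟨h, hh⟩ := C.totally Q hQ (Int.negSucc 3) g (LinearMap.ext hg)
      exact ⟨(h : X2 →ₗ[Λ] Q) ∘ₗ X'.subtype, LinearMap.ext fun x => LinearMap.congr_fun hh x⟩
    · intro Q _ _ hQ g hg
      have h0 : (g ∘ₗ a).comp d2 = 0 := by
        ext x
        have h2 : a (d2 x) = f2 (r x) := by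
          rw [hf2, hr, map_sub, map_sub, hc', hee, hae, sub_zero]
        change g (a (d2 x)) = 0
        rw [h2]
        exact LinearMap.congr_fun hg (r x)
      obtain ⟨h, hh⟩ := C.totally Q hQ (Int.negSucc 1) (g ∘ₗ a) h0
      have hh' : ∀ x : X1, (h : X0 →ₗ[Λ] Q) (d1 x) = g (a x) := fun x => LinearMap.congr_fun hh x
      refine ⟨h, ?_⟩
      ext y
      change (h : X0 →ₗ[Λ] Q) (f1 y) = g y
      rw [← hd1b, hh', hb']
    · intro Q _ _ hQ g hg
      refine C.totally Q hQ (Int.negSucc 0) g ?_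
      ext x
      change g (d1 x) = 0
      rw [← hf1a]
      exact LinearMap.congr_fun hg (a x)
  · intro Q _ _ hQ f
    have hmem : ∀ x, f2 x ∈ LinearMap.ker p := fun x => by rw [← hkf1, ← e2]; exact ⟨x, rfl⟩
    obtain ⟨h, hh⟩ := t3 Q hQ (f ∘ₗ LinearMap.codRestrict _ f2 hmem) (by
      ext x
      have : LinearMap.codRestrict _ f2 hmem (f3 x) = 0 := by
        apply Subtype.ext
        have h3 : f3 x ∈ LinearMap.range f3 := ⟨x, rfl⟩
        rw [e3] at h3
        exact h3
      change f (LinearMap.codRestrict _ f2 hmem (f3 x)) = 0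
      rw [this, map_zero])
    refine ⟨h, ?_⟩
    rintro ⟨y, hy⟩
    have : y ∈ LinearMap.range f2 := by rw [e2, hkf1]; exact hy
    obtain ⟨x, rfl⟩ := this
    exact LinearMap.congr_fun hh x

/-- Let `Λ` be an artin algebra and `M` a finitely generated Gorenstein
projective `Λ`-module which is indecomposable and non-projective.  Then its syzygy `Ω(M)`,
the kernel of a projective cover `p : P → M`, is again an indecomposable non-projective
Gorenstein projective `Λ`-module. -/
theorem syzygy_of_indecomposable_nonprojective_Gorenstein_projective
    (R : Type u) [CommRing R] [IsArtinianRing R]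
    (Λ : Type u) [Ring Λ] [Algebra R Λ] [Module.Finite R Λ]
    (M : Type u) [AddCommGroup M] [Module Λ M] [Module.Finite Λ M]
    (hM : IsGorensteinProjective Λ M) (hind : IsIndecomposable Λ M)
    (hnp : ¬ Module.Projective Λ M)
    (P : Type u) [AddCommGroup P] [Module Λ P] [Module.Finite Λ P]
    (p : P →ₗ[Λ] M) (hp : IsProjectiveCover p) :
    IsGorensteinProjective Λ ↥(LinearMap.ker p) ∧
      IsIndecomposable Λ ↥(LinearMap.ker p) ∧
      ¬ Module.Projective Λ ↥(LinearMap.ker p) := by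
  have : IsNoetherianRing R := inferInstance
  have : IsArtinianRing Λ := isArtinian_of_tower R inferInstance
  have : IsNoetherianRing Λ := isNoetherian_of_tower R inferInstance
  have : IsArtinian Λ M := inferInstance
  have : IsNoetherian Λ M := inferInstance
  have : IsNoetherian Λ P := inferInstance
  obtain ⟨hG, hext⟩ := ker_GP_main M hM P p hp
  obtain ⟨hP, hps, hpk⟩ := hp
  -- a split submodule inside the kernel vanishes
  have hsplit : ∀ (h : P →ₗ[Λ] P) , (∀ x ∈ LinearMap.range h, h x = x) →
      LinearMap.range h ≤ LinearMap.ker p → h = 0 := by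
    intro h h1 h2
    rw [← LinearMap.ker_eq_top]
    apply hpk
    rw [eq_top_iff]
    intro y _
    rw [Submodule.mem_sup]
    refine ⟨y - h y, ?_, h y, h2 ⟨y, rfl⟩, by abel⟩
    rw [LinearMap.mem_ker, map_sub, h1 (h y) ⟨y, rfl⟩, sub_self]
  have hne : LinearMap.ker p ≠ ⊥ := by
    intro hk
    exact hnp (Module.Projective.of_equiv
      (LinearEquiv.ofBijective p ⟨LinearMap.ker_eq_bot.mp hk, hps⟩))
  refine ⟨hG, ⟨(Submodule.nontrivial_iff_ne_bot).mpr hne, ?_⟩, ?_⟩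
  · intro N N' hNN
    let ε : LinearMap.ker p →ₗ[Λ] LinearMap.ker p := N.subtype ∘ₗ N.projectionOnto N' hNN
    have hεN : ∀ x ∈ N, ε x = x := fun x hx => by
      change ((N.projectionOnto N' hNN x : N) : LinearMap.ker p) = x
      exact congrArg Subtype.val (Submodule.projectionOnto_apply_left hNN ⟨x, hx⟩)
    have hεmem : ∀ x, ε x ∈ N := fun x => (N.projectionOnto N' hNN x).2
    obtain ⟨φ, hφ⟩ := hext P hP ((LinearMap.ker p).subtype ∘ₗ ε)
    have hφ' : ∀ x : LinearMap.ker p, φ x = (ε x : P) := hφ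
    have hle : LinearMap.ker p ≤ LinearMap.ker (p ∘ₗ φ) := by
      intro x hx
      change p (φ x) = 0
      rw [hφ' ⟨x, hx⟩]
      exact (ε ⟨x, hx⟩).2
    let ψ : M →ₗ[Λ] M := (LinearMap.ker p).liftQ (p ∘ₗ φ) hle ∘ₗ
      (p.quotKerEquivOfSurjective hps).symm.toLinearMap
    have hψ : ∀ x, ψ (p x) = p (φ x) := by
      intro x
      have : (p.quotKerEquivOfSurjective hps).symm (p x) = Submodule.Quotient.mk x := by
        rw [LinearEquiv.symm_apply_eq]; rfl
      change (LinearMap.ker p).liftQ (p ∘ₗ φ) hle ((p.quotKerEquivOfSurjective hps).symm (p x)) = _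
      rw [this]; rfl
    have hψn : ∀ n x, (ψ ^ n) (p x) = p ((φ ^ n) x) := by
      intro n
      induction n with
      | zero => intro x; rfl
      | succ k ih =>
        intro x
        rw [pow_succ, pow_succ, Module.End.mul_apply, Module.End.mul_apply, hψ, ih]
    have hφn : ∀ n (x : LinearMap.ker p), x ∈ N → (φ ^ n) (x : P) = x := by
      intro n
      induction n with
      | zero => intro x _; rfl
      | succ k ih =>
        intro x hx
        rw [pow_succ, Module.End.mul_apply, hφ', hεN x hx, ih x hx]
    obtain ⟨n, hn, hn1⟩ := ((LinearMap.eventually_isCompl_ker_pow_range_pow ψ).and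
      (Filter.eventually_ge_atTop 1)).exists
    rcases hind.2 _ _ hn with h | h
    · right
      have hinj : Function.Injective (ψ ^ n) := LinearMap.ker_eq_bot.mp h
      have hrt : LinearMap.range (ψ ^ n) = ⊤ := by
        have := hn.sup_eq_top
        rwa [h, bot_sup_eq] at this
      have hφs : Function.Surjective (φ ^ n) := by
        rw [← LinearMap.range_eq_top]
        apply hpk
        rw [eq_top_iff]
        intro y _
        obtain ⟨m, hm⟩ := LinearMap.range_eq_top.mp hrt (p y)
        obtain ⟨x, rfl⟩ := hps m
        rw [Submodule.mem_sup]
        refine ⟨(φ ^ n) x, ⟨x, rfl⟩, y - (φ ^ n) x, ?_, by abel⟩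
        rw [LinearMap.mem_ker, map_sub, ← hψn, hm, sub_self]
      have hφi : Function.Injective (φ ^ n) := IsNoetherian.injective_of_surjective_endomorphism _ hφs
      rw [eq_top_iff]
      intro x _
      obtain ⟨k, rfl⟩ : ∃ k, n = k + 1 := ⟨n - 1, by omega⟩
      have : x = ε x := by
        apply Subtype.ext
        apply hφi
        rw [hφn _ _ (hεmem x), pow_succ, Module.End.mul_apply, hφ', hφn _ _ (hεmem x)]
      rw [this]; exact hεmem x
    · left
      have hmem : ∀ x, (φ ^ n) x ∈ LinearMap.ker p := fun x => by
        rw [LinearMap.mem_ker, ← hψn]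
        have : p x ∈ LinearMap.ker (ψ ^ n) := h ▸ Submodule.mem_top
        exact this
      let q : P →ₗ[Λ] P := (LinearMap.ker p).subtype ∘ₗ ε ∘ₗ LinearMap.codRestrict _ (φ ^ n) hmem
      have hqN : ∀ x : LinearMap.ker p, x ∈ N → q x = x := by
        intro x hx
        have : LinearMap.codRestrict _ (φ ^ n) hmem (x : P) = x := Subtype.ext (hφn n x hx)
        change ((ε (LinearMap.codRestrict _ (φ ^ n) hmem (x : P)) : LinearMap.ker p) : P) = x
        rw [this, hεN x hx]
      have hq0 : q = 0 := by
        apply hsplit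
        · rintro _ ⟨y, rfl⟩
          exact hqN _ (hεmem _)
        · rintro _ ⟨y, rfl⟩
          exact (ε _).2
      rw [eq_bot_iff]
      intro x hx
      rw [Submodule.mem_bot]
      apply Subtype.ext
      rw [← hqN x hx, hq0]; rfl
  · intro hΩ
    obtain ⟨h, hh⟩ := hext _ hΩ LinearMap.id
    have h0 : (LinearMap.ker p).subtype ∘ₗ h = 0 := by
      apply hsplit
      · rintro _ ⟨y, rfl⟩
        exact congrArg Subtype.val (hh (h y))
      · rintro _ ⟨y, rfl⟩
        exact (h y).2
    apply hne
    rw [eq_bot_iff]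
    intro x hx
    have h1 := LinearMap.congr_fun h0 x
    have h2 : ((h x : LinearMap.ker p) : P) = x := congrArg Subtype.val (hh ⟨x, hx⟩)
    rw [Submodule.mem_bot, ← h2]
    exact h1
end
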